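/- For the Liouville equation u_tx = e^u (that is, g(u) = e^u), a smooth function Λ(x,u,u_x,u_xx,u_xxx) is a conservation-law multiplier if and only if there exists a smooth function f = f(x,ξ) of two real variables such that Λ(x,u,u_x,u_xx,u_xxx) = (∂f/∂ξ)(x,ξ)·(u_xxx − u_x·u_xx) + (∂f/∂x)(x,ξ) + u_x·f(x,ξ), where ξ = u_xx − u_x²/2. -/

import Mathlib

noncomputable section

/-- Partial derivative with respect to the first variable (t). -/
def pdt (u : ℝ → ℝ → ℝ) : ℝ → ℝ → ℝ := fun t x => deriv (fun s => u s x) t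

/-- Partial derivative with respect to the second variable (x). -/
def pdx (u : ℝ → ℝ → ℝ) : ℝ → ℝ → ℝ := fun t x => deriv (fun y => u t y) x

/-- Mixed partial derivative ∂_t^i ∂_x^j u. -/
def pd (i j : ℕ) (u : ℝ → ℝ → ℝ) : ℝ → ℝ → ℝ := pdt^[i] (pdx^[j] u)

/-- Index set for the partial derivatives ∂_t^i ∂_x^j u of total order i + j ≤ n. -/
abbrev JetIdx (n : ℕ) := {p : Fin (n + 1) × Fin (n + 1) // (p.1 : ℕ) + (p.2 : ℕ) ≤ n}

/-- The collection of all partial derivatives of u of total order ≤ n at (t,x). -/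
def jet (n : ℕ) (u : ℝ → ℝ → ℝ) (t x : ℝ) : JetIdx n → ℝ :=
  fun p => pd (p.1.1 : ℕ) (p.1.2 : ℕ) u t x

/-- Smoothness of a function of two real variables. -/
def Smooth2 (u : ℝ → ℝ → ℝ) : Prop :=
  ContDiff ℝ (⊤ : ℕ∞) (fun p : ℝ × ℝ => u p.1 p.2)

/-- Smoothness of a function of five real variables. -/
def Smooth5 (Λ : ℝ → ℝ → ℝ → ℝ → ℝ → ℝ) : Prop :=
  ContDiff ℝ (⊤ : ℕ∞)
    (fun v : ℝ × ℝ × ℝ × ℝ × ℝ => Λ v.1 v.2.1 v.2.2.1 v.2.2.2.1 v.2.2.2.2)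

/-- `Λ(x,u,u_x,u_xx,u_xxx)` is a conservation-law multiplier for the
Klein–Gordon equation `u_tx = g(u)` in light-cone coordinates:  there are
smooth fluxes `Φᵗ, Φˣ`, depending on `t`, `x` and the partial derivatives of
`u` of total order at most `4`, such that
`(u_tx − g(u))·Λ = D_t Φᵗ + D_x Φˣ` holds pointwise for every smooth
`u : ℝ² → ℝ`. -/
def IsMultiplierKG (g : ℝ → ℝ) (Λ : ℝ → ℝ → ℝ → ℝ → ℝ → ℝ) : Prop :=
  ∃ Φt Φx : ℝ × ℝ × (JetIdx 4 → ℝ) → ℝ,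
    ContDiff ℝ (⊤ : ℕ∞) Φt ∧ ContDiff ℝ (⊤ : ℕ∞) Φx ∧
    ∀ u : ℝ → ℝ → ℝ, Smooth2 u → ∀ t x : ℝ,
      (pd 1 1 u t x - g (u t x)) *
          Λ x (u t x) (pd 0 1 u t x) (pd 0 2 u t x) (pd 0 3 u t x)
        = deriv (fun s => Φt (s, x, jet 4 u s x)) t
          + deriv (fun y => Φx (t, y, jet 4 u t y)) x

open MeasureTheory

lemma Smooth2.differentiableAt {u : ℝ → ℝ → ℝ} (hu : Smooth2 u) (p : ℝ × ℝ) :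
    DifferentiableAt ℝ (fun p : ℝ × ℝ => u p.1 p.2) p :=
  ContDiff.differentiable hu (by simp) p

lemma Smooth2.hasDerivAt_left {u : ℝ → ℝ → ℝ} (hu : Smooth2 u) (t x : ℝ) :
    HasDerivAt (fun s => u s x) (fderiv ℝ (fun p : ℝ × ℝ => u p.1 p.2) (t, x) (1, 0)) t :=
  (hu.differentiableAt (t, x)).hasFDerivAt.comp_hasDerivAt t
    (f := fun s => (s, x)) ((hasDerivAt_id t).prodMk (hasDerivAt_const t x))

lemma Smooth2.hasDerivAt_right {u : ℝ → ℝ → ℝ} (hu : Smooth2 u) (t x : ℝ) :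
    HasDerivAt (fun y => u t y) (fderiv ℝ (fun p : ℝ × ℝ => u p.1 p.2) (t, x) (0, 1)) x :=
  (hu.differentiableAt (t, x)).hasFDerivAt.comp_hasDerivAt x
    (f := fun y => (t, y)) ((hasDerivAt_const x t).prodMk (hasDerivAt_id x))

lemma Smooth2.pdt_eq {u : ℝ → ℝ → ℝ} (hu : Smooth2 u) (t x : ℝ) :
    pdt u t x = fderiv ℝ (fun p : ℝ × ℝ => u p.1 p.2) (t, x) (1, 0) :=
  (hu.hasDerivAt_left t x).deriv

lemma Smooth2.pdx_eq {u : ℝ → ℝ → ℝ} (hu : Smooth2 u) (t x : ℝ) :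
    pdx u t x = fderiv ℝ (fun p : ℝ × ℝ => u p.1 p.2) (t, x) (0, 1) :=
  (hu.hasDerivAt_right t x).deriv

lemma Smooth2.hasDerivAt_pdt {u : ℝ → ℝ → ℝ} (hu : Smooth2 u) (t x : ℝ) :
    HasDerivAt (fun s => u s x) (pdt u t x) t :=
  hu.pdt_eq t x ▸ hu.hasDerivAt_left t x

lemma Smooth2.hasDerivAt_pdx {u : ℝ → ℝ → ℝ} (hu : Smooth2 u) (t x : ℝ) :
    HasDerivAt (fun y => u t y) (pdx u t x) x :=
  hu.pdx_eq t x ▸ hu.hasDerivAt_right t x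

lemma ContDiff.fderiv_apply_const {E F : Type*} [NormedAddCommGroup E] [NormedSpace ℝ E]
    [NormedAddCommGroup F] [NormedSpace ℝ F] {f : E → F} (hf : ContDiff ℝ (⊤ : ℕ∞) f) (v : E) :
    ContDiff ℝ (⊤ : ℕ∞) (fun p => fderiv ℝ f p v) :=
  (hf.fderiv_right (by simp)).clm_apply contDiff_const

lemma Smooth2.pdt {u : ℝ → ℝ → ℝ} (hu : Smooth2 u) : Smooth2 (pdt u) := by
  unfold Smooth2
  simpa only [hu.pdt_eq] using ContDiff.fderiv_apply_const hu (1, 0)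

lemma Smooth2.pdx {u : ℝ → ℝ → ℝ} (hu : Smooth2 u) : Smooth2 (pdx u) := by
  unfold Smooth2
  simpa only [hu.pdx_eq] using ContDiff.fderiv_apply_const hu (0, 1)

lemma Smooth2.pdt_iterate {u : ℝ → ℝ → ℝ} (hu : Smooth2 u) (i : ℕ) :
    Smooth2 (_root_.pdt^[i] u) := by
  induction i with
  | zero => exact hu
  | succ i ih => rw [Function.iterate_succ_apply']; exact ih.pdt

lemma Smooth2.pdx_iterate {u : ℝ → ℝ → ℝ} (hu : Smooth2 u) (i : ℕ) :
    Smooth2 (_root_.pdx^[i] u) := by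
  induction i with
  | zero => exact hu
  | succ i ih => rw [Function.iterate_succ_apply']; exact ih.pdx

lemma Smooth2.pd {u : ℝ → ℝ → ℝ} (hu : Smooth2 u) (i j : ℕ) : Smooth2 (pd i j u) :=
  (hu.pdx_iterate j).pdt_iterate i

lemma Smooth2.jet {u : ℝ → ℝ → ℝ} (hu : Smooth2 u) (n : ℕ) :
    ContDiff ℝ (⊤ : ℕ∞) (fun p : ℝ × ℝ => jet n u p.1 p.2) :=
  contDiff_pi.2 fun _ => hu.pd _ _

lemma fderiv_fderiv_apply_comm {E : Type*} [NormedAddCommGroup E] [NormedSpace ℝ E] {f : E → ℝ}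
    (hf : ContDiff ℝ (⊤ : ℕ∞) f) (p a b : E) :
    fderiv ℝ (fun q => fderiv ℝ f q a) p b = fderiv ℝ (fun q => fderiv ℝ f q b) p a := by
  have hd : DifferentiableAt ℝ (fderiv ℝ f) p :=
    (hf.fderiv_right (m := 1) (by norm_cast)).differentiable (by simp) p
  have hs : IsSymmSndFDerivAt ℝ f p :=
    hf.contDiffAt.isSymmSndFDerivAt (by simp; norm_cast)
  rw [fderiv_clm_apply hd (by fun_prop), fderiv_clm_apply hd (by fun_prop)]
  simpa using hs.eq b a

lemma Smooth2.pdt_pdx_comm {u : ℝ → ℝ → ℝ} (hu : Smooth2 u) :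
    _root_.pdt (_root_.pdx u) = _root_.pdx (_root_.pdt u) := by
  funext t x
  rw [hu.pdx.pdt_eq, hu.pdt.pdx_eq]
  have h1 : (fun p : ℝ × ℝ => _root_.pdx u p.1 p.2)
      = fun p => fderiv ℝ (fun p : ℝ × ℝ => u p.1 p.2) p (0, 1) :=
    funext fun p => hu.pdx_eq p.1 p.2
  have h2 : (fun p : ℝ × ℝ => _root_.pdt u p.1 p.2)
      = fun p => fderiv ℝ (fun p : ℝ × ℝ => u p.1 p.2) p (1, 0) :=
    funext fun p => hu.pdt_eq p.1 p.2
  rw [h1, h2]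
  exact fderiv_fderiv_apply_comm hu _ _ _

lemma pdt_add_smul {w v : ℝ → ℝ → ℝ} (hw : Smooth2 w) (hv : Smooth2 v) (ε : ℝ) :
    pdt (fun t x => w t x + ε * v t x) = fun t x => pdt w t x + ε * pdt v t x := by
  funext t x
  exact ((hw.hasDerivAt_pdt t x).add ((hv.hasDerivAt_pdt t x).const_mul ε)).deriv

lemma pdx_add_smul {w v : ℝ → ℝ → ℝ} (hw : Smooth2 w) (hv : Smooth2 v) (ε : ℝ) :
    pdx (fun t x => w t x + ε * v t x) = fun t x => pdx w t x + ε * pdx v t x := by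
  funext t x
  exact ((hw.hasDerivAt_pdx t x).add ((hv.hasDerivAt_pdx t x).const_mul ε)).deriv

lemma pd_add_smul {w v : ℝ → ℝ → ℝ} (hw : Smooth2 w) (hv : Smooth2 v) (ε : ℝ) (i j : ℕ) :
    pd i j (fun t x => w t x + ε * v t x) = fun t x => pd i j w t x + ε * pd i j v t x := by
  have hx : pdx^[j] (fun t x => w t x + ε * v t x)
      = fun t x => pdx^[j] w t x + ε * pdx^[j] v t x := by
    induction j with
    | zero => rfl
    | succ j ih =>
      simp only [Function.iterate_succ_apply', ih]
      exact pdx_add_smul (hw.pdx_iterate j) (hv.pdx_iterate j) ε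
  unfold pd
  rw [hx]
  induction i with
  | zero => rfl
  | succ i ih =>
    simp only [Function.iterate_succ_apply', ih]
    exact pdt_add_smul ((hw.pdx_iterate j).pdt_iterate i) ((hv.pdx_iterate j).pdt_iterate i) ε

lemma Smooth2.mul {A v : ℝ → ℝ → ℝ} (hA : Smooth2 A) (hv : Smooth2 v) :
    Smooth2 (fun t x => A t x * v t x) := ContDiff.mul hA hv

lemma HasCompactSupport.pdt {v : ℝ → ℝ → ℝ} (hv : Smooth2 v)
    (hc : HasCompactSupport (fun p : ℝ × ℝ => v p.1 p.2)) :
    HasCompactSupport (fun p : ℝ × ℝ => pdt v p.1 p.2) := by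
  rw [show (fun p : ℝ × ℝ => _root_.pdt v p.1 p.2) = _ from funext fun p => hv.pdt_eq p.1 p.2]
  exact hc.fderiv_apply ℝ (1, 0)

lemma HasCompactSupport.pdx {v : ℝ → ℝ → ℝ} (hv : Smooth2 v)
    (hc : HasCompactSupport (fun p : ℝ × ℝ => v p.1 p.2)) :
    HasCompactSupport (fun p : ℝ × ℝ => pdx v p.1 p.2) := by
  rw [show (fun p : ℝ × ℝ => _root_.pdx v p.1 p.2) = _ from funext fun p => hv.pdx_eq p.1 p.2]
  exact hc.fderiv_apply ℝ (0, 1)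

lemma integral_fderiv_apply_eq_zero {H : ℝ × ℝ → ℝ} (hH : ContDiff ℝ (⊤ : ℕ∞) H)
    (hc : HasCompactSupport H) (a : ℝ × ℝ) : ∫ p, fderiv ℝ H p a = 0 := by
  have h := integral_mul_fderiv_eq_neg_fderiv_mul_of_integrable (μ := (volume : Measure (ℝ × ℝ)))
    (f := fun _ => (1 : ℝ)) (g := H) (v := a) (by simp)
    (by
      simpa using (ContDiff.fderiv_apply_const hH a).continuous.integrable_of_hasCompactSupport
        (hc.fderiv_apply ℝ a))
    (by simpa using hH.continuous.integrable_of_hasCompactSupport hc)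
    (by fun_prop) (fun x _ => hH.differentiable (by simp) x)
  simpa using h

lemma integral_pdt_eq_zero {H : ℝ → ℝ → ℝ} (hH : Smooth2 H)
    (hc : HasCompactSupport (fun p : ℝ × ℝ => H p.1 p.2)) :
    ∫ p : ℝ × ℝ, pdt H p.1 p.2 = 0 := by
  simpa only [hH.pdt_eq] using integral_fderiv_apply_eq_zero hH hc (1, 0)

lemma integral_pdx_eq_zero {H : ℝ → ℝ → ℝ} (hH : Smooth2 H)
    (hc : HasCompactSupport (fun p : ℝ × ℝ => H p.1 p.2)) :
    ∫ p : ℝ × ℝ, pdx H p.1 p.2 = 0 := by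
  simpa only [hH.pdx_eq] using integral_fderiv_apply_eq_zero hH hc (0, 1)

lemma integrable_mul_test {A v : ℝ → ℝ → ℝ} (hA : Smooth2 A) (hv : Smooth2 v)
    (hc : HasCompactSupport (fun p : ℝ × ℝ => v p.1 p.2)) :
    Integrable (fun p : ℝ × ℝ => A p.1 p.2 * v p.1 p.2) :=
  (ContDiff.continuous (hA.mul hv)).integrable_of_hasCompactSupport hc.mul_left

lemma pdt_mul {A v : ℝ → ℝ → ℝ} (hA : Smooth2 A) (hv : Smooth2 v) :
    pdt (fun t x => A t x * v t x) = fun t x => pdt A t x * v t x + A t x * pdt v t x := by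
  funext t x
  exact ((hA.hasDerivAt_pdt t x).mul (hv.hasDerivAt_pdt t x)).deriv

lemma pdx_mul {A v : ℝ → ℝ → ℝ} (hA : Smooth2 A) (hv : Smooth2 v) :
    pdx (fun t x => A t x * v t x) = fun t x => pdx A t x * v t x + A t x * pdx v t x := by
  funext t x
  exact ((hA.hasDerivAt_pdx t x).mul (hv.hasDerivAt_pdx t x)).deriv

lemma integral_mul_pdt {A v : ℝ → ℝ → ℝ} (hA : Smooth2 A) (hv : Smooth2 v)
    (hc : HasCompactSupport (fun p : ℝ × ℝ => v p.1 p.2)) :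
    ∫ p : ℝ × ℝ, A p.1 p.2 * pdt v p.1 p.2 = -∫ p : ℝ × ℝ, pdt A p.1 p.2 * v p.1 p.2 := by
  have h := integral_pdt_eq_zero (hA.mul hv) hc.mul_left
  rw [pdt_mul hA hv] at h
  rw [integral_add (integrable_mul_test hA.pdt hv hc)
    (integrable_mul_test hA hv.pdt (hc.pdt hv))] at h
  linarith

lemma integral_mul_pdx {A v : ℝ → ℝ → ℝ} (hA : Smooth2 A) (hv : Smooth2 v)
    (hc : HasCompactSupport (fun p : ℝ × ℝ => v p.1 p.2)) :
    ∫ p : ℝ × ℝ, A p.1 p.2 * pdx v p.1 p.2 = -∫ p : ℝ × ℝ, pdx A p.1 p.2 * v p.1 p.2 := by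
  have h := integral_pdx_eq_zero (hA.mul hv) hc.mul_left
  rw [pdx_mul hA hv] at h
  rw [integral_add (integrable_mul_test hA.pdx hv hc)
    (integrable_mul_test hA hv.pdx (hc.pdx hv))] at h
  linarith

lemma hasDerivAt_deriv_comp_add_smul {V : Type*} [NormedAddCommGroup V] [NormedSpace ℝ V]
    {Φ : V → ℝ} (hΦ : ContDiff ℝ (⊤ : ℕ∞) Φ) {γ δ : ℝ → V} (hγ : ContDiff ℝ (⊤ : ℕ∞) γ)
    (hδ : ContDiff ℝ (⊤ : ℕ∞) δ) (t : ℝ) :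
    HasDerivAt (fun ε : ℝ => deriv (fun s => Φ (γ s + ε • δ s)) t)
      (deriv (fun s => fderiv ℝ Φ (γ s) (δ s)) t) 0 := by
  set G : ℝ → ℝ → ℝ := fun ε s => Φ (γ s + ε • δ s) with hGdef
  have hG : Smooth2 G := by
    unfold Smooth2
    fun_prop
  have h := hG.pdx.hasDerivAt_pdt 0 t
  rw [hG.pdt_pdx_comm] at h
  have hH : ∀ s, pdt G 0 s = fderiv ℝ Φ (γ s) (δ s) := by
    intro s
    have h1 : HasDerivAt (fun ε : ℝ => γ s + ε • δ s) (δ s) 0 := by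
      simpa using ((hasDerivAt_id (0 : ℝ)).smul_const (δ s)).const_add (γ s)
    have h2 : HasFDerivAt Φ (fderiv ℝ Φ (γ s)) (γ s + (0 : ℝ) • δ s) := by
      simpa using (hΦ.differentiable (by simp) (γ s)).hasFDerivAt
    exact (h2.comp_hasDerivAt (0 : ℝ) h1).deriv
  have hd : pdx (pdt G) 0 t = deriv (fun s => fderiv ℝ Φ (γ s) (δ s)) t := by
    unfold pdx
    simp only [hH]
  rw [← hd]
  exact h

lemma HasCompactSupport.pd {v : ℝ → ℝ → ℝ} (hv : Smooth2 v)
    (hc : HasCompactSupport (fun p : ℝ × ℝ => v p.1 p.2)) (i j : ℕ) :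
    HasCompactSupport (fun p : ℝ × ℝ => pd i j v p.1 p.2) := by
  have hx : HasCompactSupport (fun p : ℝ × ℝ => _root_.pdx^[j] v p.1 p.2) := by
    induction j with
    | zero => exact hc
    | succ j ih =>
      simp only [Function.iterate_succ_apply']
      exact ih.pdx (hv.pdx_iterate j)
  unfold _root_.pd
  induction i with
  | zero => exact hx
  | succ i ih =>
    simp only [Function.iterate_succ_apply']
    exact ih.pdt ((hv.pdx_iterate j).pdt_iterate i)

lemma HasCompactSupport.jet {v : ℝ → ℝ → ℝ} (hv : Smooth2 v)
    (hc : HasCompactSupport (fun p : ℝ × ℝ => v p.1 p.2)) (n : ℕ) :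
    HasCompactSupport (fun p : ℝ × ℝ => jet n v p.1 p.2) := by
  refine HasCompactSupport.intro
    (K := ⋃ k : JetIdx n, tsupport (fun p : ℝ × ℝ => _root_.pd k.1.1 k.1.2 v p.1 p.2))
    (isCompact_iUnion fun k => hc.pd hv _ _) fun p hp => ?_
  funext k
  simp only [Set.mem_iUnion, not_exists] at hp
  exact image_eq_zero_of_notMem_tsupport
    (f := fun p : ℝ × ℝ => _root_.pd k.1.1 k.1.2 v p.1 p.2) (hp k)

/-- The point `(x, w, w_x, w_xx, w_xxx)` of the jet space on which a multiplier depends. -/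
def xJet (w : ℝ → ℝ → ℝ) (t x : ℝ) : ℝ × ℝ × ℝ × ℝ × ℝ :=
  (x, w t x, pdx w t x, pdx (pdx w) t x, pdx (pdx (pdx w)) t x)

/-- The partial derivative with respect to `x` of a function of `(x, u, u_x, u_xx, u_xxx)`. -/
def partialX (F : ℝ × ℝ × ℝ × ℝ × ℝ → ℝ) (P : ℝ × ℝ × ℝ × ℝ × ℝ) : ℝ :=
  fderiv ℝ F P (1, 0, 0, 0, 0)

/-- The partial derivative with respect to `u` of a function of `(x, u, u_x, u_xx, u_xxx)`. -/
def partialU (F : ℝ × ℝ × ℝ × ℝ × ℝ → ℝ) (P : ℝ × ℝ × ℝ × ℝ × ℝ) : ℝ :=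
  fderiv ℝ F P (0, 1, 0, 0, 0)

/-- The partial derivative with respect to `u_x` of a function of `(x, u, u_x, u_xx, u_xxx)`. -/
def partialP (F : ℝ × ℝ × ℝ × ℝ × ℝ → ℝ) (P : ℝ × ℝ × ℝ × ℝ × ℝ) : ℝ :=
  fderiv ℝ F P (0, 0, 1, 0, 0)

/-- The partial derivative with respect to `u_xx` of a function of `(x, u, u_x, u_xx, u_xxx)`. -/
def partialQ (F : ℝ × ℝ × ℝ × ℝ × ℝ → ℝ) (P : ℝ × ℝ × ℝ × ℝ × ℝ) : ℝ :=
  fderiv ℝ F P (0, 0, 0, 1, 0)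

/-- The partial derivative with respect to `u_xxx` of a function of `(x, u, u_x, u_xx, u_xxx)`. -/
def partialR (F : ℝ × ℝ × ℝ × ℝ × ℝ → ℝ) (P : ℝ × ℝ × ℝ × ℝ × ℝ) : ℝ :=
  fderiv ℝ F P (0, 0, 0, 0, 1)

lemma fderiv_apply_jet (F : ℝ × ℝ × ℝ × ℝ × ℝ → ℝ) (P : ℝ × ℝ × ℝ × ℝ × ℝ) (m a b c d : ℝ) :
    fderiv ℝ F P (m, a, b, c, d) = m * partialX F P + a * partialU F P
      + b * partialP F P + c * partialQ F P + d * partialR F P := by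
  have h : ((m, a, b, c, d) : ℝ × ℝ × ℝ × ℝ × ℝ) = m • (1, 0, 0, 0, 0) + a • (0, 1, 0, 0, 0)
      + b • (0, 0, 1, 0, 0) + c • (0, 0, 0, 1, 0) + d • (0, 0, 0, 0, 1) := by
    simp
  rw [h]
  simp only [map_add, map_smul, smul_eq_mul, partialX, partialU, partialP, partialQ, partialR]

lemma Smooth2.xJet {w : ℝ → ℝ → ℝ} (hw : Smooth2 w) :
    ContDiff ℝ (⊤ : ℕ∞) (fun p : ℝ × ℝ => xJet w p.1 p.2) :=
  contDiff_snd.prodMk (ContDiff.prodMk hw (ContDiff.prodMk hw.pdx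
    (ContDiff.prodMk hw.pdx.pdx hw.pdx.pdx.pdx)))

lemma Smooth2.comp_xJet {w : ℝ → ℝ → ℝ} (hw : Smooth2 w) {F : ℝ × ℝ × ℝ × ℝ × ℝ → ℝ}
    (hF : ContDiff ℝ (⊤ : ℕ∞) F) : Smooth2 (fun t x => F (_root_.xJet w t x)) :=
  hF.comp hw.xJet

lemma xJet_add_smul {w v : ℝ → ℝ → ℝ} (hw : Smooth2 w) (hv : Smooth2 v) (ε t x : ℝ) :
    xJet (fun t x => w t x + ε * v t x) t x = xJet w t x
      + ε • (0, v t x, pdx v t x, pdx (pdx v) t x, pdx (pdx (pdx v)) t x) := by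
  simp only [xJet, pdx_add_smul hw hv, pdx_add_smul hw.pdx hv.pdx,
    pdx_add_smul hw.pdx.pdx hv.pdx.pdx]
  simp

lemma integral_firstVariation_eq_zero {Λ : ℝ → ℝ → ℝ → ℝ → ℝ → ℝ}
    {F : ℝ × ℝ × ℝ × ℝ × ℝ → ℝ} (hFΛ : ∀ x u p q r, F (x, u, p, q, r) = Λ x u p q r)
    (hF : ContDiff ℝ (⊤ : ℕ∞) F)
    (h : IsMultiplierKG Real.exp Λ) {w v : ℝ → ℝ → ℝ} (hw : Smooth2 w) (hv : Smooth2 v)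
    (hc : HasCompactSupport (fun p : ℝ × ℝ => v p.1 p.2)) :
    ∫ p : ℝ × ℝ, ((pdt (pdx v) p.1 p.2 - Real.exp (w p.1 p.2) * v p.1 p.2) * F (xJet w p.1 p.2)
      + (pdt (pdx w) p.1 p.2 - Real.exp (w p.1 p.2)) * fderiv ℝ F (xJet w p.1 p.2)
        (0, v p.1 p.2, pdx v p.1 p.2, pdx (pdx v) p.1 p.2, pdx (pdx (pdx v)) p.1 p.2)) = 0 := by
  obtain ⟨Φt, Φx, hΦt, hΦx, h⟩ := h
  have hjet : ∀ ε t x, jet 4 (fun t x => w t x + ε * v t x) t x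
      = jet 4 w t x + ε • jet 4 v t x := by
    intro ε t x
    funext k
    simp [jet, pd_add_smul hw hv]
  have hw4 := hw.jet 4
  have hv4 := hv.jet 4
  let H (Φ : ℝ × ℝ × (JetIdx 4 → ℝ) → ℝ) (t x : ℝ) : ℝ :=
    fderiv ℝ Φ (t, x, jet 4 w t x) (0, 0, jet 4 v t x)
  have hHs : ∀ Φ, ContDiff ℝ (⊤ : ℕ∞) Φ → Smooth2 (H Φ) := by
    intro Φ hΦ
    refine ContDiff.clm_apply (f := fun p : ℝ × ℝ => fderiv ℝ Φ (p.1, p.2, jet 4 w p.1 p.2)) ?_ ?_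
    · exact (hΦ.fderiv_right (m := (⊤ : ℕ∞)) (by simp)).comp
        (contDiff_fst.prodMk (contDiff_snd.prodMk hw4))
    · exact contDiff_const.prodMk (contDiff_const.prodMk hv4)
  have hHc : ∀ Φ, HasCompactSupport (fun p : ℝ × ℝ => H Φ p.1 p.2) := by
    intro Φ
    refine (hc.jet hv 4).mono fun p hp hp' => hp ?_
    change jet 4 v p.1 p.2 = 0 at hp'
    change fderiv ℝ Φ _ (0, 0, jet 4 v p.1 p.2) = 0
    rw [hp']
    exact map_zero _
  have key : ∀ t x,
      (pdt (pdx v) t x - Real.exp (w t x) * v t x) * F (xJet w t x)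
      + (pdt (pdx w) t x - Real.exp (w t x)) * fderiv ℝ F (xJet w t x)
        (0, v t x, pdx v t x, pdx (pdx v) t x, pdx (pdx (pdx v)) t x)
      = pdt (H Φt) t x + pdx (H Φx) t x := by
    intro t x
    have ht := hasDerivAt_deriv_comp_add_smul hΦt (γ := fun s => (s, x, jet 4 w s x))
      (δ := fun s => (0, 0, jet 4 v s x))
      (contDiff_id.prodMk (contDiff_const.prodMk (hw4.comp (contDiff_id.prodMk contDiff_const))))
      (contDiff_const.prodMk (contDiff_const.prodMk
        (hv4.comp (contDiff_id.prodMk contDiff_const)))) t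
    have hx := hasDerivAt_deriv_comp_add_smul hΦx (γ := fun y => (t, y, jet 4 w t y))
      (δ := fun y => (0, 0, jet 4 v t y))
      (contDiff_const.prodMk (contDiff_id.prodMk (hw4.comp (contDiff_const.prodMk contDiff_id))))
      (contDiff_const.prodMk (contDiff_const.prodMk
        (hv4.comp (contDiff_const.prodMk contDiff_id)))) x
    have hsum := ht.add hx
    have hE : HasDerivAt (fun ε : ℝ => (pdt (pdx w) t x + ε * pdt (pdx v) t x)
        - Real.exp (w t x + ε * v t x)) (pdt (pdx v) t x - Real.exp (w t x) * v t x) 0 := by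
      have hlin : ∀ a b : ℝ, HasDerivAt (fun ε : ℝ => a + ε * b) b 0 := fun a b => by
        simpa using ((hasDerivAt_id (0 : ℝ)).mul_const b).const_add a
      exact ((hlin _ _).sub (hlin (w t x) (v t x)).exp).congr_deriv (by simp)
    have hFd : HasDerivAt (fun ε : ℝ => F (xJet w t x
        + ε • (0, v t x, pdx v t x, pdx (pdx v) t x, pdx (pdx (pdx v)) t x)))
        (fderiv ℝ F (xJet w t x)
          (0, v t x, pdx v t x, pdx (pdx v) t x, pdx (pdx (pdx v)) t x)) 0 := by
      set d : ℝ × ℝ × ℝ × ℝ × ℝ :=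
        (0, v t x, pdx v t x, pdx (pdx v) t x, pdx (pdx (pdx v)) t x)
      have h1 : HasDerivAt (fun ε : ℝ => xJet w t x + ε • d) d 0 := by
        simpa using ((hasDerivAt_id (0 : ℝ)).smul_const d).const_add (xJet w t x)
      have h2 : HasFDerivAt F (fderiv ℝ F (xJet w t x)) (xJet w t x + (0 : ℝ) • d) := by
        simpa using (hF.differentiable (by simp) (xJet w t x)).hasFDerivAt
      exact h2.comp_hasDerivAt (0 : ℝ) h1
    have hL := hE.mul hFd
    have hεs : ∀ ε : ℝ, Smooth2 (fun t x => w t x + ε * v t x) := fun ε =>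
      ContDiff.add hw (ContDiff.mul contDiff_const hv)
    have heq : ∀ ε : ℝ, ((pdt (pdx w) t x + ε * pdt (pdx v) t x)
        - Real.exp (w t x + ε * v t x)) * F (xJet w t x
        + ε • (0, v t x, pdx v t x, pdx (pdx v) t x, pdx (pdx (pdx v)) t x))
        = deriv (fun s => Φt ((s, x, jet 4 w s x) + ε • (0, 0, jet 4 v s x))) t
          + deriv (fun y => Φx ((t, y, jet 4 w t y) + ε • (0, 0, jet 4 v t y))) x := by
      intro ε
      have h0 := h _ (hεs ε) t x
      rw [← hFΛ] at h0
      have hJ : (x, w t x + ε * v t x, pd 0 1 (fun t x => w t x + ε * v t x) t x,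
          pd 0 2 (fun t x => w t x + ε * v t x) t x, pd 0 3 (fun t x => w t x + ε * v t x) t x)
          = xJet w t x
            + ε • (0, v t x, pdx v t x, pdx (pdx v) t x, pdx (pdx (pdx v)) t x) :=
        xJet_add_smul hw hv ε t x
      rw [hJ, pd_add_smul hw hv] at h0
      simp only [hjet] at h0
      simpa [pd] using h0
    have h3 := (hL.congr_of_eventuallyEq
      (Filter.Eventually.of_forall fun ε => (heq ε).symm)).unique hsum
    simpa [H, pdt, pdx] using h3
  have hint : ∫ p : ℝ × ℝ, (pdt (H Φt) p.1 p.2 + pdx (H Φx) p.1 p.2) = 0 := by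
    rw [integral_add]
    · rw [integral_pdt_eq_zero (hHs _ hΦt) (hHc _), integral_pdx_eq_zero (hHs _ hΦx) (hHc _),
        add_zero]
    · exact (hHs _ hΦt).pdt.continuous.integrable_of_hasCompactSupport
        ((hHc _).pdt (hHs _ hΦt))
    · exact (hHs _ hΦx).pdx.continuous.integrable_of_hasCompactSupport
        ((hHc _).pdx (hHs _ hΦx))
  rw [integral_congr_ae (Filter.Eventually.of_forall fun p : ℝ × ℝ => key p.1 p.2)]
  exact hint

lemma eq_zero_of_forall_integral_mul_eq_zero {R : ℝ → ℝ → ℝ} (hR : Smooth2 R)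
    (h : ∀ v : ℝ → ℝ → ℝ, Smooth2 v → HasCompactSupport (fun p : ℝ × ℝ => v p.1 p.2) →
      ∫ p : ℝ × ℝ, R p.1 p.2 * v p.1 p.2 = 0) (t x : ℝ) : R t x = 0 := by
  have hc : Continuous (fun p : ℝ × ℝ => R p.1 p.2) := ContDiff.continuous hR
  have hae := ae_eq_zero_of_integral_contDiff_smul_eq_zero (μ := (volume : Measure (ℝ × ℝ)))
    hc.locallyIntegrable (fun g hg hgc => by
      simpa [mul_comm] using h (fun t x => g (t, x)) hg hgc)
  exact congrFun ((Continuous.ae_eq_iff_eq volume hc continuous_const).1 hae) (t, x)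

lemma ContDiff.partialU {F : ℝ × ℝ × ℝ × ℝ × ℝ → ℝ} (hF : ContDiff ℝ (⊤ : ℕ∞) F) :
    ContDiff ℝ (⊤ : ℕ∞) (partialU F) := hF.fderiv_apply_const _

lemma ContDiff.partialP {F : ℝ × ℝ × ℝ × ℝ × ℝ → ℝ} (hF : ContDiff ℝ (⊤ : ℕ∞) F) :
    ContDiff ℝ (⊤ : ℕ∞) (partialP F) := hF.fderiv_apply_const _

lemma ContDiff.partialQ {F : ℝ × ℝ × ℝ × ℝ × ℝ → ℝ} (hF : ContDiff ℝ (⊤ : ℕ∞) F) :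
    ContDiff ℝ (⊤ : ℕ∞) (partialQ F) := hF.fderiv_apply_const _

lemma ContDiff.partialR {F : ℝ × ℝ × ℝ × ℝ × ℝ → ℝ} (hF : ContDiff ℝ (⊤ : ℕ∞) F) :
    ContDiff ℝ (⊤ : ℕ∞) (partialR F) := hF.fderiv_apply_const _

lemma integral_add_five {f₁ f₂ f₃ f₄ f₅ : ℝ × ℝ → ℝ} (h₁ : Integrable f₁) (h₂ : Integrable f₂)
    (h₃ : Integrable f₃) (h₄ : Integrable f₄) (h₅ : Integrable f₅) :
    ∫ p, (f₁ p + f₂ p + f₃ p + f₄ p + f₅ p)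
      = (∫ p, f₁ p) + (∫ p, f₂ p) + (∫ p, f₃ p) + (∫ p, f₄ p) + ∫ p, f₅ p := by
  have h₁₂ : Integrable fun p => f₁ p + f₂ p := h₁.add h₂
  have h₁₃ : Integrable fun p => f₁ p + f₂ p + f₃ p := h₁₂.add h₃
  have h₁₄ : Integrable fun p => f₁ p + f₂ p + f₃ p + f₄ p := h₁₃.add h₄
  rw [integral_add h₁₄ h₅, integral_add h₁₃ h₄, integral_add h₁₂ h₃, integral_add h₁ h₂]

lemma euler_lagrange {Λ : ℝ → ℝ → ℝ → ℝ → ℝ → ℝ}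
    {F : ℝ × ℝ × ℝ × ℝ × ℝ → ℝ} (hFΛ : ∀ x u p q r, F (x, u, p, q, r) = Λ x u p q r)
    (hF : ContDiff ℝ (⊤ : ℕ∞) F)
    (h : IsMultiplierKG Real.exp Λ) {w : ℝ → ℝ → ℝ} (hw : Smooth2 w) (t x : ℝ) :
    pdx (pdt fun t x => F (xJet w t x)) t x - Real.exp (w t x) * F (xJet w t x)
      + (pdt (pdx w) t x - Real.exp (w t x)) * partialU F (xJet w t x)
      - pdx (fun t x => (pdt (pdx w) t x - Real.exp (w t x)) * partialP F (xJet w t x)) t x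
      + pdx (pdx fun t x => (pdt (pdx w) t x - Real.exp (w t x)) * partialQ F (xJet w t x)) t x
      - pdx (pdx (pdx fun t x =>
          (pdt (pdx w) t x - Real.exp (w t x)) * partialR F (xJet w t x))) t x = 0 := by
  have hE : Smooth2 fun t x => pdt (pdx w) t x - Real.exp (w t x) :=
    ContDiff.sub hw.pdx.pdt (ContDiff.exp hw)
  have hA := hw.comp_xJet hF
  have hB : Smooth2 fun t x => -(Real.exp (w t x) * F (xJet w t x))
      + (pdt (pdx w) t x - Real.exp (w t x)) * partialU F (xJet w t x) :=
    ContDiff.add (ContDiff.neg (ContDiff.mul (ContDiff.exp hw) hA))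
      (hE.mul (hw.comp_xJet hF.partialU))
  have hP := hE.mul (hw.comp_xJet hF.partialP)
  have hQ := hE.mul (hw.comp_xJet hF.partialQ)
  have hR := hE.mul (hw.comp_xJet hF.partialR)
  have hS : Smooth2 fun t x => pdx (pdt fun t x => F (xJet w t x)) t x
      - Real.exp (w t x) * F (xJet w t x)
      + (pdt (pdx w) t x - Real.exp (w t x)) * partialU F (xJet w t x)
      - pdx (fun t x => (pdt (pdx w) t x - Real.exp (w t x)) * partialP F (xJet w t x)) t x
      + pdx (pdx fun t x => (pdt (pdx w) t x - Real.exp (w t x)) * partialQ F (xJet w t x)) t x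
      - pdx (pdx (pdx fun t x =>
          (pdt (pdx w) t x - Real.exp (w t x)) * partialR F (xJet w t x))) t x :=
    ContDiff.sub (ContDiff.add (ContDiff.sub (ContDiff.add (ContDiff.sub hA.pdt.pdx
      (ContDiff.mul (ContDiff.exp hw) hA)) (hE.mul (hw.comp_xJet hF.partialU)))
      hP.pdx) hQ.pdx.pdx) hR.pdx.pdx.pdx
  refine eq_zero_of_forall_integral_mul_eq_zero hS (fun v hv hc => ?_) t x
  have hcx := hc.pdx hv
  have hcxx := hcx.pdx hv.pdx
  have hcxxx := hcxx.pdx hv.pdx.pdx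
  have h0 := integral_firstVariation_eq_zero hFΛ hF h hw hv hc
  simp only [fderiv_apply_jet] at h0
  set A : ℝ → ℝ → ℝ := fun t x => F (xJet w t x) with hAdef
  set B : ℝ → ℝ → ℝ := fun t x => -(Real.exp (w t x) * F (xJet w t x))
      + (pdt (pdx w) t x - Real.exp (w t x)) * partialU F (xJet w t x) with hBdef
  set P : ℝ → ℝ → ℝ := fun t x =>
    (pdt (pdx w) t x - Real.exp (w t x)) * partialP F (xJet w t x) with hPdef
  set Q : ℝ → ℝ → ℝ := fun t x =>
    (pdt (pdx w) t x - Real.exp (w t x)) * partialQ F (xJet w t x) with hQdef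
  set R : ℝ → ℝ → ℝ := fun t x =>
    (pdt (pdx w) t x - Real.exp (w t x)) * partialR F (xJet w t x) with hRdef
  have i1 := integrable_mul_test hA hv.pdx.pdt (hcx.pdt hv.pdx)
  have i2 := integrable_mul_test hB hv hc
  have i3 := integrable_mul_test hP hv.pdx hcx
  have i4 := integrable_mul_test hQ hv.pdx.pdx hcxx
  have i5 := integrable_mul_test hR hv.pdx.pdx.pdx hcxxx
  have e0 : ∫ p : ℝ × ℝ, (A p.1 p.2 * pdt (pdx v) p.1 p.2 + B p.1 p.2 * v p.1 p.2
      + P p.1 p.2 * pdx v p.1 p.2 + Q p.1 p.2 * pdx (pdx v) p.1 p.2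
      + R p.1 p.2 * pdx (pdx (pdx v)) p.1 p.2) = 0 := by
    rw [← h0]
    refine integral_congr_ae (Filter.Eventually.of_forall fun p => ?_)
    simp only [hAdef, hBdef, hPdef, hQdef, hRdef]
    ring
  rw [integral_add_five i1 i2 i3 i4 i5,
    integral_mul_pdt hA hv.pdx hcx, integral_mul_pdx hA.pdt hv hc,
    integral_mul_pdx hP hv hc, integral_mul_pdx hQ hv.pdx hcx, integral_mul_pdx hQ.pdx hv hc,
    integral_mul_pdx hR hv.pdx.pdx hcxx, integral_mul_pdx hR.pdx hv.pdx hcx,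
    integral_mul_pdx hR.pdx.pdx hv hc] at e0
  have j1 := integrable_mul_test hA.pdt.pdx hv hc
  have j3 := integrable_mul_test hP.pdx hv hc
  have j4 := integrable_mul_test hQ.pdx.pdx hv hc
  have j5 := integrable_mul_test hR.pdx.pdx.pdx hv hc
  have hsum := integral_add_five j1 i2 j3.neg j4 j5.neg
  simp only [Pi.neg_apply, integral_neg] at hsum
  refine Eq.trans ?_ (hsum.trans (by linarith))
  refine integral_congr_ae (Filter.Eventually.of_forall fun p => ?_)
  simp only [hBdef]
  ring

lemma ContDiff.deriv_smooth {f : ℝ → ℝ} (hf : ContDiff ℝ (⊤ : ℕ∞) f) :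
    ContDiff ℝ (⊤ : ℕ∞) (deriv f) := hf.fderiv_apply_const 1

lemma ContDiff.hasDerivAt_deriv {f : ℝ → ℝ} (hf : ContDiff ℝ (⊤ : ℕ∞) f) (y : ℝ) :
    HasDerivAt f (deriv f y) y := (hf.differentiable (by simp) y).hasDerivAt

lemma deriv_mul_smooth {f g : ℝ → ℝ} (hf : ContDiff ℝ (⊤ : ℕ∞) f)
    (hg : ContDiff ℝ (⊤ : ℕ∞) g) :
    deriv (fun y => f y * g y) = fun y => deriv f y * g y + f y * deriv g y :=
  funext fun y => ((hf.hasDerivAt_deriv y).mul (hg.hasDerivAt_deriv y)).deriv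

lemma deriv_add_smooth {f g : ℝ → ℝ} (hf : ContDiff ℝ (⊤ : ℕ∞) f)
    (hg : ContDiff ℝ (⊤ : ℕ∞) g) :
    deriv (fun y => f y + g y) = fun y => deriv f y + deriv g y :=
  funext fun y => ((hf.hasDerivAt_deriv y).add (hg.hasDerivAt_deriv y)).deriv

lemma deriv_sub_smooth {f g : ℝ → ℝ} (hf : ContDiff ℝ (⊤ : ℕ∞) f)
    (hg : ContDiff ℝ (⊤ : ℕ∞) g) :
    deriv (fun y => f y - g y) = fun y => deriv f y - deriv g y :=
  funext fun y => ((hf.hasDerivAt_deriv y).sub (hg.hasDerivAt_deriv y)).deriv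

lemma deriv_two_mul_smooth {f g : ℝ → ℝ} (hf : ContDiff ℝ (⊤ : ℕ∞) f)
    (hg : ContDiff ℝ (⊤ : ℕ∞) g) :
    deriv (deriv fun y => f y * g y) = fun y => deriv (deriv f) y * g y
      + 2 * (deriv f y * deriv g y) + f y * deriv (deriv g) y := by
  have hf' := hf.deriv_smooth
  have hg' := hg.deriv_smooth
  rw [deriv_mul_smooth hf hg, deriv_add_smooth (hf'.mul hg) (hf.mul hg'),
    deriv_mul_smooth hf' hg, deriv_mul_smooth hf hg']
  funext y
  ring

lemma deriv_three_mul_smooth {f g : ℝ → ℝ} (hf : ContDiff ℝ (⊤ : ℕ∞) f)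
    (hg : ContDiff ℝ (⊤ : ℕ∞) g) :
    deriv (deriv (deriv fun y => f y * g y)) = fun y => deriv (deriv (deriv f)) y * g y
      + 3 * (deriv (deriv f) y * deriv g y) + 3 * (deriv f y * deriv (deriv g) y)
      + f y * deriv (deriv (deriv g)) y := by
  have hf' := hf.deriv_smooth
  have hg' := hg.deriv_smooth
  rw [deriv_mul_smooth hf hg, deriv_add_smooth (hf'.mul hg) (hf.mul hg'),
    deriv_add_smooth (hf'.mul hg).deriv_smooth (hf.mul hg').deriv_smooth,
    deriv_two_mul_smooth hf' hg, deriv_two_mul_smooth hf hg']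
  funext y
  ring

/-- The point of the jet space determined at `y` by a function `W` of one variable. -/
def curveJet (W : ℝ → ℝ) (y : ℝ) : ℝ × ℝ × ℝ × ℝ × ℝ :=
  (y, W y, deriv W y, deriv (deriv W) y, deriv (deriv (deriv W)) y)

lemma ContDiff.curveJet {W : ℝ → ℝ} (hW : ContDiff ℝ (⊤ : ℕ∞) W) :
    ContDiff ℝ (⊤ : ℕ∞) (curveJet W) :=
  contDiff_id.prodMk (hW.prodMk (hW.deriv_smooth.prodMk
    (hW.deriv_smooth.deriv_smooth.prodMk hW.deriv_smooth.deriv_smooth.deriv_smooth)))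

lemma ContDiff.comp_curveJet {F : ℝ × ℝ × ℝ × ℝ × ℝ → ℝ} (hF : ContDiff ℝ (⊤ : ℕ∞) F)
    {W : ℝ → ℝ} (hW : ContDiff ℝ (⊤ : ℕ∞) W) :
    ContDiff ℝ (⊤ : ℕ∞) (fun y => F (_root_.curveJet W y)) := hF.comp hW.curveJet

lemma deriv_comp_curveJet {F : ℝ × ℝ × ℝ × ℝ × ℝ → ℝ} (hF : ContDiff ℝ (⊤ : ℕ∞) F)
    {W : ℝ → ℝ} (hW : ContDiff ℝ (⊤ : ℕ∞) W) (y : ℝ) :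
    deriv (fun y => F (curveJet W y)) y = partialX F (curveJet W y)
      + deriv W y * partialU F (curveJet W y) + deriv (deriv W) y * partialP F (curveJet W y)
      + deriv (deriv (deriv W)) y * partialQ F (curveJet W y)
      + deriv (deriv (deriv (deriv W))) y * partialR F (curveJet W y) := by
  have h0 := hW.hasDerivAt_deriv y
  have h1 := hW.deriv_smooth.hasDerivAt_deriv y
  have h2 := hW.deriv_smooth.deriv_smooth.hasDerivAt_deriv y
  have h3 := hW.deriv_smooth.deriv_smooth.deriv_smooth.hasDerivAt_deriv y
  have hc : HasDerivAt (curveJet W) (1, deriv W y, deriv (deriv W) y,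
      deriv (deriv (deriv W)) y, deriv (deriv (deriv (deriv W))) y) y :=
    (hasDerivAt_id y).prodMk (h0.prodMk (h1.prodMk (h2.prodMk h3)))
  have h := ((hF.differentiable (by simp) (curveJet W y)).hasFDerivAt.comp_hasDerivAt y hc).deriv
  rw [fderiv_apply_jet, one_mul] at h
  exact h

lemma euler_lagrange_curve {Λ : ℝ → ℝ → ℝ → ℝ → ℝ → ℝ}
    {F : ℝ × ℝ × ℝ × ℝ × ℝ → ℝ} (hFΛ : ∀ x u p q r, F (x, u, p, q, r) = Λ x u p q r)
    (hF : ContDiff ℝ (⊤ : ℕ∞) F) (h : IsMultiplierKG Real.exp Λ) {W Z : ℝ → ℝ}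
    (hW : ContDiff ℝ (⊤ : ℕ∞) W) (hZ : ContDiff ℝ (⊤ : ℕ∞) Z) (x : ℝ) :
    deriv (fun y => Z y * partialU F (curveJet W y) + deriv Z y * partialP F (curveJet W y)
        + deriv (deriv Z) y * partialQ F (curveJet W y)
        + deriv (deriv (deriv Z)) y * partialR F (curveJet W y)) x
      - Real.exp (W x) * F (curveJet W x)
      + (deriv Z x - Real.exp (W x)) * partialU F (curveJet W x)
      - deriv (fun y => (deriv Z y - Real.exp (W y)) * partialP F (curveJet W y)) x
      + deriv (deriv fun y => (deriv Z y - Real.exp (W y)) * partialQ F (curveJet W y)) x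
      - deriv (deriv (deriv fun y =>
          (deriv Z y - Real.exp (W y)) * partialR F (curveJet W y))) x = 0 := by
  have hlin : ∀ {a b : ℝ → ℝ}, ContDiff ℝ (⊤ : ℕ∞) a → ContDiff ℝ (⊤ : ℕ∞) b →
      pdx (fun t y => a y + t * b y) = fun t y => deriv a y + t * deriv b y := by
    intro a b ha hb
    funext t y
    exact ((ha.hasDerivAt_deriv y).add ((hb.hasDerivAt_deriv y).const_mul t)).deriv
  have hW1 := hW.deriv_smooth
  have hW2 := hW1.deriv_smooth
  have hZ1 := hZ.deriv_smooth
  have hZ2 := hZ1.deriv_smooth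
  have hw : Smooth2 (fun t y => W y + t * Z y) :=
    ContDiff.add (hW.comp contDiff_snd) (contDiff_fst.mul (hZ.comp contDiff_snd))
  have h0 := euler_lagrange hFΛ hF h hw 0 x
  have hJ : ∀ t y, xJet (fun t y => W y + t * Z y) t y = curveJet W y
      + t • (0, Z y, deriv Z y, deriv (deriv Z) y, deriv (deriv (deriv Z)) y) := by
    intro t y
    simp only [xJet, hlin hW hZ, hlin hW1 hZ1, hlin hW2 hZ2, curveJet]
    simp
  have ht : ∀ y, pdt (pdx fun t y => W y + t * Z y) 0 y = deriv Z y := by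
    intro y
    rw [hlin hW hZ]
    exact (((hasDerivAt_id (0 : ℝ)).mul_const (deriv Z y)).const_add (deriv W y)).deriv.trans
      (one_mul _)
  have hA : ∀ y, pdt (fun t y => F (xJet (fun t y => W y + t * Z y) t y)) 0 y
      = Z y * partialU F (curveJet W y) + deriv Z y * partialP F (curveJet W y)
        + deriv (deriv Z) y * partialQ F (curveJet W y)
        + deriv (deriv (deriv Z)) y * partialR F (curveJet W y) := by
    intro y
    simp only [hJ]
    set d : ℝ × ℝ × ℝ × ℝ × ℝ :=
      (0, Z y, deriv Z y, deriv (deriv Z) y, deriv (deriv (deriv Z)) y) with hd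
    have h1 : HasDerivAt (fun t : ℝ => curveJet W y + t • d) d 0 := by
      simpa using ((hasDerivAt_id (0 : ℝ)).smul_const d).const_add (curveJet W y)
    have h2 : HasFDerivAt F (fderiv ℝ F (curveJet W y)) (curveJet W y + (0 : ℝ) • d) := by
      simpa using (hF.differentiable (by simp) (curveJet W y)).hasFDerivAt
    have h3 := (h2.comp_hasDerivAt (0 : ℝ) h1).deriv
    rw [hd, fderiv_apply_jet, zero_mul, zero_add] at h3
    exact h3
  have hA' : pdx (pdt fun t y => F (xJet (fun t y => W y + t * Z y) t y)) 0 x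
      = deriv (fun y => Z y * partialU F (curveJet W y) + deriv Z y * partialP F (curveJet W y)
        + deriv (deriv Z) y * partialQ F (curveJet W y)
        + deriv (deriv (deriv Z)) y * partialR F (curveJet W y)) x := by
    rw [← funext hA]
    rfl
  have hJ0 : ∀ y, xJet (fun t y => W y + t * Z y) 0 y = curveJet W y := by
    intro y
    simp [hJ]
  have hx : ∀ G : ℝ × ℝ × ℝ × ℝ × ℝ → ℝ,
      (fun y => (pdt (pdx fun t y => W y + t * Z y) 0 y - Real.exp (W y + 0 * Z y))
        * G (xJet (fun t y => W y + t * Z y) 0 y))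
      = fun y => (deriv Z y - Real.exp (W y)) * G (curveJet W y) := by
    intro G
    funext y
    rw [ht, hJ0, zero_mul, add_zero]
  rw [hA', hJ0, ht, zero_mul, add_zero] at h0
  rw [← hx, ← hx, ← hx]
  exact h0

/-- The quartic polynomial with prescribed derivatives at `x₀`. -/
def taylorQuartic (x₀ a b c d e : ℝ) (y : ℝ) : ℝ :=
  a + b * (y - x₀) + c * (y - x₀) ^ 2 / 2 + d * (y - x₀) ^ 3 / 6 + e * (y - x₀) ^ 4 / 24

lemma contDiff_taylorQuartic (x₀ a b c d e : ℝ) :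
    ContDiff ℝ (⊤ : ℕ∞) (taylorQuartic x₀ a b c d e) := by
  unfold taylorQuartic
  fun_prop

lemma deriv_taylorQuartic (x₀ a b c d e : ℝ) :
    deriv (taylorQuartic x₀ a b c d e) = taylorQuartic x₀ b c d e 0 := by
  funext y
  have h1 : HasDerivAt (fun y : ℝ => y - x₀) 1 y := (hasDerivAt_id y).sub_const x₀
  have h := ((((h1.const_mul b).const_add a).add (((h1.pow 2).const_mul c).div_const 2)).add
    (((h1.pow 3).const_mul d).div_const 6)).add (((h1.pow 4).const_mul e).div_const 24)
  refine Eq.trans (HasDerivAt.deriv h) ?_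
  simp only [taylorQuartic]
  push_cast
  ring

lemma taylorQuartic_self (x₀ a b c d e : ℝ) : taylorQuartic x₀ a b c d e x₀ = a := by
  simp [taylorQuartic]

lemma curveJet_taylorQuartic (x₀ a b c d e : ℝ) :
    curveJet (taylorQuartic x₀ a b c d e) x₀ = (x₀, a, b, c, d) := by
  simp only [curveJet, deriv_taylorQuartic, taylorQuartic_self]

lemma linearized_euler_lagrange {Λ : ℝ → ℝ → ℝ → ℝ → ℝ → ℝ}
    {F : ℝ × ℝ × ℝ × ℝ × ℝ → ℝ} (hFΛ : ∀ x u p q r, F (x, u, p, q, r) = Λ x u p q r)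
    (hF : ContDiff ℝ (⊤ : ℕ∞) F) (h : IsMultiplierKG Real.exp Λ) {W Z : ℝ → ℝ}
    (hW : ContDiff ℝ (⊤ : ℕ∞) W) (hZ : ContDiff ℝ (⊤ : ℕ∞) Z) (x : ℝ) :
    deriv (fun y => partialU F (curveJet W y)) x * Z x
      + 2 * (partialU F (curveJet W x) * deriv Z x)
      + 2 * (partialQ F (curveJet W x) * deriv (deriv (deriv Z)) x)
      - 2 * (deriv (fun y => partialR F (curveJet W y)) x * deriv (deriv (deriv Z)) x)
      + 3 * (deriv (fun y => partialQ F (curveJet W y)) x * deriv (deriv Z) x)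
      - 3 * (deriv (deriv (fun y => partialR F (curveJet W y))) x * deriv (deriv Z) x)
      + deriv (deriv (fun y => partialQ F (curveJet W y))) x * deriv Z x
      - deriv (deriv (deriv (fun y => partialR F (curveJet W y)))) x * deriv Z x = 0 := by
  have e1 := euler_lagrange_curve hFΛ hF h hW hZ x
  have e0 := euler_lagrange_curve hFΛ hF h hW (contDiff_const (c := (0 : ℝ))) x
  have hU := hF.partialU.comp_curveJet hW
  have hP := hF.partialP.comp_curveJet hW
  have hQ := hF.partialQ.comp_curveJet hW
  have hR := hF.partialR.comp_curveJet hW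
  have hE : ContDiff ℝ (⊤ : ℕ∞) fun y => Real.exp (W y) := hW.exp
  have hE' : ContDiff ℝ (⊤ : ℕ∞) fun y => (0 : ℝ) - Real.exp (W y) := contDiff_const.sub hE
  have hZ1 := hZ.deriv_smooth
  have hZ2 := hZ1.deriv_smooth
  have hZ3 := hZ2.deriv_smooth
  have hZE : ContDiff ℝ (⊤ : ℕ∞) fun y => deriv Z y - Real.exp (W y) := hZ1.sub hE
  have hd0 : deriv (fun _ : ℝ => (0 : ℝ)) = fun _ => 0 := by
    funext y
    simp
  simp only [hd0] at e0
  rw [deriv_mul_smooth hE' hP, deriv_two_mul_smooth hE' hQ, deriv_three_mul_smooth hE' hR,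
    deriv_sub_smooth contDiff_const hE,
    deriv_sub_smooth contDiff_const.deriv_smooth hE.deriv_smooth,
    deriv_sub_smooth contDiff_const.deriv_smooth.deriv_smooth hE.deriv_smooth.deriv_smooth] at e0
  rw [deriv_mul_smooth hZE hP, deriv_two_mul_smooth hZE hQ, deriv_three_mul_smooth hZE hR,
    deriv_sub_smooth hZ1 hE, deriv_sub_smooth hZ2 hE.deriv_smooth,
    deriv_sub_smooth hZ3 hE.deriv_smooth.deriv_smooth,
    deriv_add_smooth (((hZ.mul hU).add (hZ1.mul hP)).add (hZ2.mul hQ)) (hZ3.mul hR),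
    deriv_add_smooth ((hZ.mul hU).add (hZ1.mul hP)) (hZ2.mul hQ),
    deriv_add_smooth (hZ.mul hU) (hZ1.mul hP), deriv_mul_smooth hZ hU, deriv_mul_smooth hZ1 hP,
    deriv_mul_smooth hZ2 hQ, deriv_mul_smooth hZ3 hR] at e1
  simp only [hd0, zero_mul, add_zero] at e0
  linear_combination e1 - e0

lemma partialQ_eq_deriv_partialR {Λ : ℝ → ℝ → ℝ → ℝ → ℝ → ℝ}
    {F : ℝ × ℝ × ℝ × ℝ × ℝ → ℝ} (hFΛ : ∀ x u p q r, F (x, u, p, q, r) = Λ x u p q r)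
    (hF : ContDiff ℝ (⊤ : ℕ∞) F) (h : IsMultiplierKG Real.exp Λ) {W : ℝ → ℝ}
    (hW : ContDiff ℝ (⊤ : ℕ∞) W) :
    (fun y => partialQ F (curveJet W y)) = deriv fun y => partialR F (curveJet W y) := by
  funext x
  have h0 := linearized_euler_lagrange hFΛ hF h hW (contDiff_taylorQuartic x 0 0 0 1 0) x
  simp only [deriv_taylorQuartic, taylorQuartic_self] at h0
  linarith

lemma partialU_eq_zero {Λ : ℝ → ℝ → ℝ → ℝ → ℝ → ℝ}
    {F : ℝ × ℝ × ℝ × ℝ × ℝ → ℝ} (hFΛ : ∀ x u p q r, F (x, u, p, q, r) = Λ x u p q r)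
    (hF : ContDiff ℝ (⊤ : ℕ∞) F) (h : IsMultiplierKG Real.exp Λ) :
    partialU F = fun _ => 0 := by
  funext ⟨x, u, p, q, r⟩
  have hW := contDiff_taylorQuartic x u p q r 0
  have h0 := linearized_euler_lagrange hFΛ hF h hW (contDiff_taylorQuartic x 0 1 0 0 0) x
  rw [partialQ_eq_deriv_partialR hFΛ hF h hW] at h0
  simp only [deriv_taylorQuartic, taylorQuartic_self, curveJet_taylorQuartic] at h0
  linarith

/-- The differential polynomial `K` for which `e^u F` is the total derivative of `e^u K`
whenever `F` is a multiplier of the Liouville equation. -/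
def potential (F : ℝ × ℝ × ℝ × ℝ × ℝ → ℝ) (P : ℝ × ℝ × ℝ × ℝ × ℝ) : ℝ :=
  partialP F P + P.2.2.2.1 * partialR F P + P.2.2.1 * partialQ F P
    + P.2.2.1 ^ 2 * partialR F P

lemma ContDiff.potential {F : ℝ × ℝ × ℝ × ℝ × ℝ → ℝ} (hF : ContDiff ℝ (⊤ : ℕ∞) F) :
    ContDiff ℝ (⊤ : ℕ∞) (potential F) := by
  have hP := hF.partialP
  have hQ := hF.partialQ
  have hR := hF.partialR
  unfold _root_.potential
  fun_prop

lemma deriv_potential_curve {Λ : ℝ → ℝ → ℝ → ℝ → ℝ → ℝ}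
    {F : ℝ × ℝ × ℝ × ℝ × ℝ → ℝ} (hFΛ : ∀ x u p q r, F (x, u, p, q, r) = Λ x u p q r)
    (hF : ContDiff ℝ (⊤ : ℕ∞) F) (h : IsMultiplierKG Real.exp Λ) {W : ℝ → ℝ}
    (hW : ContDiff ℝ (⊤ : ℕ∞) W) (x : ℝ) :
    deriv (fun y => potential F (curveJet W y)) x + deriv W x * potential F (curveJet W x)
      = F (curveJet W x) := by
  have e0 := euler_lagrange_curve hFΛ hF h hW (contDiff_const (c := (0 : ℝ))) x
  have hP := hF.partialP.comp_curveJet hW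
  have hQ := hF.partialQ.comp_curveJet hW
  have hR := hF.partialR.comp_curveJet hW
  have hK := hF.potential.comp_curveJet hW
  have hE : ContDiff ℝ (⊤ : ℕ∞) fun y => Real.exp (W y) := hW.exp
  have hE' : ContDiff ℝ (⊤ : ℕ∞) fun y => (0 : ℝ) - Real.exp (W y) := contDiff_const.sub hE
  have hW1 := hW.deriv_smooth
  have hQR := partialQ_eq_deriv_partialR hFΛ hF h hW
  have hd0 : deriv (fun _ : ℝ => (0 : ℝ)) = fun _ => 0 := by
    funext y
    simp
  have hdE : deriv (fun y => Real.exp (W y)) = fun y => Real.exp (W y) * deriv W y :=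
    funext fun y => (hW.hasDerivAt_deriv y).exp.deriv
  have hdE' : deriv (fun y => (0 : ℝ) - Real.exp (W y))
      = fun y => (0 - Real.exp (W y)) * deriv W y := by
    rw [deriv_sub_smooth contDiff_const hE, hd0, hdE]
    funext y
    ring
  set A : ℝ → ℝ := fun y => Real.exp (W y) * (deriv W y * partialR F (curveJet W y)) with hA
  have hAs : ContDiff ℝ (⊤ : ℕ∞) A := hE.mul (hW1.mul hR)
  have hRd : deriv (fun y => (0 - Real.exp (W y)) * partialR F (curveJet W y))
      = fun y => (0 - Real.exp (W y)) * partialQ F (curveJet W y) - A y := by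
    rw [deriv_mul_smooth hE' hR, hdE', ← hQR]
    funext y
    simp only [hA]
    ring
  have hPd : deriv (fun y => (0 - Real.exp (W y)) * partialP F (curveJet W y)) x
      = -deriv (fun y => Real.exp (W y) * partialP F (curveJet W y)) x := by
    rw [← deriv.fun_neg]
    congr 1
    funext y
    ring
  have hAd : deriv A = fun y => Real.exp (W y) * (deriv W y ^ 2 * partialR F (curveJet W y)
      + deriv (deriv W) y * partialR F (curveJet W y)
      + deriv W y * partialQ F (curveJet W y)) := by
    rw [hA, deriv_mul_smooth hE (hW1.mul hR), deriv_mul_smooth hW1 hR, hdE, ← hQR]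
    funext y
    ring
  have hsum : (fun y => Real.exp (W y) * potential F (curveJet W y))
      = fun y => Real.exp (W y) * partialP F (curveJet W y) + deriv A y := by
    rw [hAd]
    funext y
    simp only [potential, curveJet]
    ring
  have hKd := congrFun (congrArg deriv hsum) x
  rw [deriv_mul_smooth hE hK, deriv_add_smooth (hE.mul hP) hAs.deriv_smooth, hdE] at hKd
  simp only [hd0, zero_mul, add_zero] at e0
  rw [hRd, deriv_sub_smooth (hE'.mul hQ) hAs, deriv_sub_smooth (hE'.mul hQ).deriv_smooth
    hAs.deriv_smooth, hPd, partialU_eq_zero hFΛ hF h] at e0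
  have hpos := Real.exp_pos (W x)
  refine mul_left_cancel₀ hpos.ne' ?_
  simp only at hKd e0
  linear_combination hKd + e0

lemma ContDiff.partialX {F : ℝ × ℝ × ℝ × ℝ × ℝ → ℝ} (hF : ContDiff ℝ (⊤ : ℕ∞) F) :
    ContDiff ℝ (⊤ : ℕ∞) (partialX F) := hF.fderiv_apply_const _

lemma ContDiff.hasDerivAt_comp_add_smul {F : ℝ × ℝ × ℝ × ℝ × ℝ → ℝ}
    (hF : ContDiff ℝ (⊤ : ℕ∞) F) {γ : ℝ → ℝ × ℝ × ℝ × ℝ × ℝ} {γ' : ℝ × ℝ × ℝ × ℝ × ℝ} {s : ℝ}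
    (hγ : HasDerivAt γ γ' s) : HasDerivAt (fun y => F (γ y)) (fderiv ℝ F (γ s) γ') s :=
  (hF.differentiable (by simp) (γ s)).hasFDerivAt.comp_hasDerivAt s hγ

lemma ContDiff.hasDerivAt_partialX {F : ℝ × ℝ × ℝ × ℝ × ℝ → ℝ} (hF : ContDiff ℝ (⊤ : ℕ∞) F)
    (x u p q r : ℝ) :
    HasDerivAt (fun s => F (s, u, p, q, r)) (_root_.partialX F (x, u, p, q, r)) x :=
  hF.hasDerivAt_comp_add_smul ((hasDerivAt_id x).prodMk (hasDerivAt_const x (u, p, q, r)))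

lemma ContDiff.hasDerivAt_partialU {F : ℝ × ℝ × ℝ × ℝ × ℝ → ℝ} (hF : ContDiff ℝ (⊤ : ℕ∞) F)
    (x u p q r : ℝ) :
    HasDerivAt (fun s => F (x, s, p, q, r)) (_root_.partialU F (x, u, p, q, r)) u :=
  hF.hasDerivAt_comp_add_smul ((hasDerivAt_const u x).prodMk
    ((hasDerivAt_id u).prodMk (hasDerivAt_const u (p, q, r))))

lemma ContDiff.hasDerivAt_partialQ {F : ℝ × ℝ × ℝ × ℝ × ℝ → ℝ} (hF : ContDiff ℝ (⊤ : ℕ∞) F)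
    (x u p q r : ℝ) :
    HasDerivAt (fun s => F (x, u, p, s, r)) (_root_.partialQ F (x, u, p, q, r)) q :=
  hF.hasDerivAt_comp_add_smul ((hasDerivAt_const q x).prodMk ((hasDerivAt_const q u).prodMk
    ((hasDerivAt_const q p).prodMk ((hasDerivAt_id q).prodMk (hasDerivAt_const q r)))))

lemma ContDiff.hasDerivAt_partialR {F : ℝ × ℝ × ℝ × ℝ × ℝ → ℝ} (hF : ContDiff ℝ (⊤ : ℕ∞) F)
    (x u p q r : ℝ) :
    HasDerivAt (fun s => F (x, u, p, q, s)) (_root_.partialR F (x, u, p, q, r)) r :=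
  hF.hasDerivAt_comp_add_smul ((hasDerivAt_const r x).prodMk ((hasDerivAt_const r u).prodMk
    ((hasDerivAt_const r p).prodMk ((hasDerivAt_const r q).prodMk (hasDerivAt_id r)))))

lemma fderiv_fderiv_apply_eq_zero {E : Type*} [NormedAddCommGroup E] [NormedSpace ℝ E]
    {f : E → ℝ} (hf : ContDiff ℝ (⊤ : ℕ∞) f) {b : E} (hb : (fun q => fderiv ℝ f q b) = fun _ => 0)
    (p a : E) : fderiv ℝ (fun q => fderiv ℝ f q a) p b = 0 := by
  rw [fderiv_fderiv_apply_comm hf, hb]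
  simp

/-- A function of `(x, u, u_x, u_xx, u_xxx)` annihilated by `∂_u`, `∂_{u_xxx}` and
`∂_{u_x} + u_x ∂_{u_xx}` depends only on `x` and `u_xx - u_x² / 2`. -/
lemma eq_comp_of_partial_eq_zero {K : ℝ × ℝ × ℝ × ℝ × ℝ → ℝ} (hK : ContDiff ℝ (⊤ : ℕ∞) K)
    (hU : partialU K = fun _ => 0) (hR : partialR K = fun _ => 0)
    (hPQ : ∀ x u p q r, partialP K (x, u, p, q, r) + p * partialQ K (x, u, p, q, r) = 0)
    (x u p q r : ℝ) : K (x, u, p, q, r) = K (x, 0, 0, q - p ^ 2 / 2, 0) := by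
  have h1 : ∀ a b, K (x, a, p, q, r) = K (x, b, p, q, r) :=
    is_const_of_deriv_eq_zero (fun s => (hK.hasDerivAt_partialU x s p q r).differentiableAt)
      fun s => (hK.hasDerivAt_partialU x s p q r).deriv.trans (congrFun hU _)
  have h2 : ∀ a b, K (x, 0, p, q, a) = K (x, 0, p, q, b) :=
    is_const_of_deriv_eq_zero (fun s => (hK.hasDerivAt_partialR x 0 p q s).differentiableAt)
      fun s => (hK.hasDerivAt_partialR x 0 p q s).deriv.trans (congrFun hR _)
  have h3 : ∀ s, HasDerivAt (fun s => K (x, 0, s, q - p ^ 2 / 2 + s ^ 2 / 2, 0)) 0 s := by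
    intro s
    have hs : HasDerivAt (fun s : ℝ => q - p ^ 2 / 2 + s ^ 2 / 2) s s :=
      ((((hasDerivAt_id s).pow 2).div_const 2).const_add (q - p ^ 2 / 2)).congr_deriv (by simp)
    refine (hK.hasDerivAt_comp_add_smul ((hasDerivAt_const s x).prodMk
      ((hasDerivAt_const s (0 : ℝ)).prodMk ((hasDerivAt_id s).prodMk
        (hs.prodMk (hasDerivAt_const s (0 : ℝ))))))).congr_deriv ?_
    rw [fderiv_apply_jet]
    have := hPQ x 0 s (q - p ^ 2 / 2 + s ^ 2 / 2) 0
    simp only [id]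
    linarith
  have h4 := is_const_of_deriv_eq_zero (fun s => (h3 s).differentiableAt)
    (fun s => (h3 s).deriv) p 0
  rw [h1 u 0, h2 r 0]
  have e1 : q - p ^ 2 / 2 + p ^ 2 / 2 = q := by ring
  have e2 : q - p ^ 2 / 2 + 0 ^ 2 / 2 = q - p ^ 2 / 2 := by ring
  rwa [e1, e2] at h4

lemma exists_eq_of_isMultiplierKG {Λ : ℝ → ℝ → ℝ → ℝ → ℝ → ℝ} (hΛ : Smooth5 Λ)
    (h : IsMultiplierKG Real.exp Λ) :
    ∃ f : ℝ → ℝ → ℝ, ContDiff ℝ (⊤ : ℕ∞) (fun v : ℝ × ℝ => f v.1 v.2) ∧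
      ∀ x u p q r : ℝ, Λ x u p q r = deriv (fun ξ => f x ξ) (q - p ^ 2 / 2) * (r - p * q)
        + deriv (fun y => f y (q - p ^ 2 / 2)) x + p * f x (q - p ^ 2 / 2) := by
  set F : ℝ × ℝ × ℝ × ℝ × ℝ → ℝ := fun v => Λ v.1 v.2.1 v.2.2.1 v.2.2.2.1 v.2.2.2.2
  have hFΛ : ∀ x u p q r, F (x, u, p, q, r) = Λ x u p q r := fun _ _ _ _ _ => rfl
  have hF : ContDiff ℝ (⊤ : ℕ∞) F := hΛ
  have hK := hF.potential
  have hUF := partialU_eq_zero hFΛ hF h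
  have hFK : ∀ x u p q r s, partialX (potential F) (x, u, p, q, r)
      + p * partialU (potential F) (x, u, p, q, r) + q * partialP (potential F) (x, u, p, q, r)
      + r * partialQ (potential F) (x, u, p, q, r) + s * partialR (potential F) (x, u, p, q, r)
      + p * potential F (x, u, p, q, r) = F (x, u, p, q, r) := by
    intro x u p q r s
    have hW := contDiff_taylorQuartic x u p q r s
    have h0 := deriv_potential_curve hFΛ hF h hW x
    rw [deriv_comp_curveJet hK hW] at h0
    simpa only [curveJet_taylorQuartic, deriv_taylorQuartic, taylorQuartic_self] using h0
  have hQF : ∀ x u p q r, partialQ F (x, u, p, q, r) = partialX (partialR F) (x, u, p, q, r)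
      + p * partialU (partialR F) (x, u, p, q, r) + q * partialP (partialR F) (x, u, p, q, r)
      + r * partialQ (partialR F) (x, u, p, q, r) := by
    intro x u p q r
    have hW := contDiff_taylorQuartic x u p q r 0
    have h0 := congrFun (partialQ_eq_deriv_partialR hFΛ hF h hW) x
    rw [deriv_comp_curveJet hF.partialR hW] at h0
    simpa only [curveJet_taylorQuartic, deriv_taylorQuartic, taylorQuartic_self, zero_mul,
      add_zero] using h0
  have hRK : partialR (potential F) = fun _ => 0 := by
    funext ⟨x, u, p, q, r⟩
    linarith [hFK x u p q r 0, hFK x u p q r 1]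
  have hUK : partialU (potential F) = fun _ => 0 := by
    funext ⟨x, u, p, q, r⟩
    have hd := (((hF.partialP.hasDerivAt_partialU x u p q r).add
      ((hF.partialR.hasDerivAt_partialU x u p q r).const_mul q)).add
      ((hF.partialQ.hasDerivAt_partialU x u p q r).const_mul p)).add
      ((hF.partialR.hasDerivAt_partialU x u p q r).const_mul (p ^ 2))
    have hz : ∀ P a, partialU (fun q => fderiv ℝ F q a) P = 0 :=
      fderiv_fderiv_apply_eq_zero hF hUF
    have h1 : partialU (partialP F) (x, u, p, q, r) = 0 := hz _ _
    have h2 : partialU (partialQ F) (x, u, p, q, r) = 0 := hz _ _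
    have h3 : partialU (partialR F) (x, u, p, q, r) = 0 := hz _ _
    rw [h1, h2, h3] at hd
    simpa using (hK.hasDerivAt_partialU x u p q r).unique hd
  have hFK' : ∀ x u p q r, F (x, u, p, q, r) = partialX (potential F) (x, u, p, q, r)
      + q * partialP (potential F) (x, u, p, q, r) + r * partialQ (potential F) (x, u, p, q, r)
      + p * potential F (x, u, p, q, r) := by
    intro x u p q r
    rw [← hFK x u p q r 0, hUK]
    ring
  have hRF : partialR F = partialQ (potential F) := by
    funext ⟨x, u, p, q, r⟩
    have hd := (((hK.partialX.hasDerivAt_partialR x u p q r).add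
      ((hK.partialP.hasDerivAt_partialR x u p q r).const_mul q)).add
      ((hasDerivAt_id r).mul (hK.partialQ.hasDerivAt_partialR x u p q r))).add
      ((hK.hasDerivAt_partialR x u p q r).const_mul p)
    have hz : ∀ P a, partialR (fun q => fderiv ℝ (potential F) q a) P = 0 :=
      fderiv_fderiv_apply_eq_zero hK hRK
    have h1 : partialR (partialX (potential F)) (x, u, p, q, r) = 0 := hz _ _
    have h2 : partialR (partialP (potential F)) (x, u, p, q, r) = 0 := hz _ _
    have h3 : partialR (partialQ (potential F)) (x, u, p, q, r) = 0 := hz _ _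
    rw [h1, h2, h3, hRK] at hd
    simpa using (hF.hasDerivAt_partialR x u p q r).unique (hd.congr_of_eventuallyEq
      (Filter.Eventually.of_forall fun s => hFK' x u p q s))
  have hPQ : ∀ x u p q r, partialP (potential F) (x, u, p, q, r)
      + p * partialQ (potential F) (x, u, p, q, r) = 0 := by
    intro x u p q r
    have hd := (((hK.partialX.hasDerivAt_partialQ x u p q r).add
      ((hasDerivAt_id q).mul (hK.partialP.hasDerivAt_partialQ x u p q r))).add
      ((hK.partialQ.hasDerivAt_partialQ x u p q r).const_mul r)).add
      ((hK.hasDerivAt_partialQ x u p q r).const_mul p)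
    have hd' := (hF.hasDerivAt_partialQ x u p q r).unique (hd.congr_of_eventuallyEq
      (Filter.Eventually.of_forall fun s => hFK' x u p s r))
    have h1 : partialQ (partialX (potential F)) (x, u, p, q, r)
        = partialX (partialQ (potential F)) (x, u, p, q, r) := fderiv_fderiv_apply_comm hK _ _ _
    have h2 : partialQ (partialP (potential F)) (x, u, p, q, r)
        = partialP (partialQ (potential F)) (x, u, p, q, r) := fderiv_fderiv_apply_comm hK _ _ _
    have h3 : partialU (partialQ (potential F)) (x, u, p, q, r) = 0 :=
      fderiv_fderiv_apply_eq_zero hK hUK _ _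
    have h4 := hQF x u p q r
    rw [hRF, h3] at h4
    rw [h1, h2] at hd'
    simp only [id] at hd'
    linarith
  have hKf := eq_comp_of_partial_eq_zero hK hUK hRK hPQ
  refine ⟨fun x ξ => potential F (x, 0, 0, ξ, 0), hK.comp (contDiff_fst.prodMk
    (contDiff_const.prodMk (contDiff_const.prodMk (contDiff_snd.prodMk contDiff_const)))), ?_⟩
  intro x u p q r
  have hx : partialX (potential F) (x, u, p, q, r)
      = deriv (fun y => potential F (y, 0, 0, q - p ^ 2 / 2, 0)) x := by
    rw [← (hK.hasDerivAt_partialX x u p q r).deriv]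
    simp only [hKf _ u p q r]
  have hq : partialQ (potential F) (x, u, p, q, r)
      = deriv (fun ξ => potential F (x, 0, 0, ξ, 0)) (q - p ^ 2 / 2) := by
    rw [← (hK.hasDerivAt_partialQ x u p q r).deriv, ← deriv_comp_sub_const]
    simp only [hKf x u p _ r]
  have h0 := hFK' x u p q r
  have h1 := hPQ x u p q r
  rw [← hFΛ, ← hx, ← hq]
  beta_reduce
  rw [← hKf x u p q r]
  linear_combination h0 + q * h1


lemma hasFDerivAt_intervalIntegral_param {H E : Type} [NormedAddCommGroup H] [NormedSpace ℝ H]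
    [ProperSpace H] [NormedAddCommGroup E] [NormedSpace ℝ E] {g : H × ℝ → E}
    (hg : ContDiff ℝ (⊤ : ℕ∞) g) (a b : ℝ) (h : H) :
    HasFDerivAt (fun h => ∫ s in a..b, g (h, s))
      (∫ s in a..b, (fderiv ℝ g (h, s)).comp (ContinuousLinearMap.inl ℝ H ℝ)) h := by
  have hc : Continuous fun p : H × ℝ => (fderiv ℝ g p).comp (ContinuousLinearMap.inl ℝ H ℝ) :=
    ((hg.fderiv_right (m := (⊤ : ℕ∞)) (by simp)).continuous).clm_comp_const _
  obtain ⟨C, hC⟩ := ((isCompact_closedBall h 1).prod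
    (isCompact_uIcc (a := a) (b := b))).exists_bound_of_continuousOn hc.continuousOn
  refine intervalIntegral.hasFDerivAt_integral_of_dominated_of_fderiv_le
    (F := fun h s => g (h, s)) (bound := fun _ => C)
    (F' := fun h s => (fderiv ℝ g (h, s)).comp (ContinuousLinearMap.inl ℝ H ℝ))
    (Metric.closedBall_mem_nhds h one_pos) (Filter.Eventually.of_forall fun y => ?_) ?_ ?_ ?_ ?_ ?_
  · exact (hg.continuous.comp (by fun_prop : Continuous fun s : ℝ => (y, s))).aestronglyMeasurable
  · exact (hg.continuous.comp
      (by fun_prop : Continuous fun s : ℝ => (h, s))).intervalIntegrable a b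
  · exact (hc.comp (by fun_prop : Continuous fun s : ℝ => (h, s))).aestronglyMeasurable
  · exact Filter.Eventually.of_forall fun s hs y hy => hC (y, s) ⟨hy, Set.uIoc_subset_uIcc hs⟩
  · exact intervalIntegrable_const
  · exact Filter.Eventually.of_forall fun s _ y _ =>
      (hg.differentiable (by simp) (y, s)).hasFDerivAt.comp y (hasFDerivAt_prodMk_left y s)

lemma ContDiff.intervalIntegral_param {H E : Type} [NormedAddCommGroup H] [NormedSpace ℝ H]
    [ProperSpace H] [NormedAddCommGroup E] [NormedSpace ℝ E] {g : H × ℝ → E}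
    (hg : ContDiff ℝ (⊤ : ℕ∞) g) (a b : ℝ) :
    ContDiff ℝ (⊤ : ℕ∞) (fun h => ∫ s in a..b, g (h, s)) := by
  rw [contDiff_infty]
  intro n
  induction n generalizing E with
  | zero =>
    exact contDiff_zero.2 (intervalIntegral.continuous_parametric_intervalIntegral_of_continuous'
      (f := fun h s => g (h, s)) hg.continuous a b)
  | succ n ih =>
    push_cast
    rw [contDiff_succ_iff_hasFDerivAt]
    exact ⟨_, ih (g := fun p => (fderiv ℝ g p).comp (ContinuousLinearMap.inl ℝ H ℝ))
      ((hg.fderiv_right (by simp)).clm_comp contDiff_const),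
      hasFDerivAt_intervalIntegral_param hg a b⟩

lemma exists_smooth_primitive {f : ℝ → ℝ → ℝ} (hf : Smooth2 f) :
    ∃ A : ℝ → ℝ → ℝ, Smooth2 A ∧ pdx A = f := by
  refine ⟨fun x ξ => ∫ s in (0 : ℝ)..ξ, f x s, ?_, ?_⟩
  · have hg : ContDiff ℝ (⊤ : ℕ∞) fun P : (ℝ × ℝ) × ℝ => f P.1.1 (P.1.2 * P.2) :=
      ContDiff.comp (g := fun p : ℝ × ℝ => f p.1 p.2) hf (by fun_prop :
        ContDiff ℝ (⊤ : ℕ∞) fun P : (ℝ × ℝ) × ℝ => (P.1.1, P.1.2 * P.2))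
    have h := contDiff_snd.mul (hg.intervalIntegral_param 0 1)
    refine Eq.mp (congrArg (ContDiff ℝ (⊤ : ℕ∞)) (funext fun p => ?_)) h
    simp
  · funext x ξ
    have hc : Continuous (f x) :=
      (ContDiff.continuous hf).comp (by fun_prop : Continuous fun s : ℝ => (x, s))
    exact (intervalIntegral.integral_hasDerivAt_right (hc.intervalIntegrable 0 ξ)
      (hc.stronglyMeasurableAtFilter _ _) hc.continuousAt).deriv

lemma Smooth2.hasDerivAt_comp {f : ℝ → ℝ → ℝ} (hf : Smooth2 f) {a b : ℝ → ℝ} {a' b' s : ℝ}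
    (ha : HasDerivAt a a' s) (hb : HasDerivAt b b' s) :
    HasDerivAt (fun s => f (a s) (b s))
      (a' * _root_.pdt f (a s) (b s) + b' * _root_.pdx f (a s) (b s)) s := by
  refine ((hf.differentiableAt (a s, b s)).hasFDerivAt.comp_hasDerivAt s
    (ha.prodMk hb)).congr_deriv ?_
  have h : ((a', b') : ℝ × ℝ) = a' • (1, 0) + b' • (0, 1) := by simp
  rw [h, map_add, map_smul, map_smul, ← hf.pdt_eq, ← hf.pdx_eq]
  rfl

lemma isMultiplierKG_of_eq {Λ : ℝ → ℝ → ℝ → ℝ → ℝ → ℝ} {f : ℝ → ℝ → ℝ} (hf : Smooth2 f)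
    (h : ∀ x u p q r : ℝ, Λ x u p q r = pdx f x (q - p ^ 2 / 2) * (r - p * q)
      + pdt f x (q - p ^ 2 / 2) + p * f x (q - p ^ 2 / 2)) :
    IsMultiplierKG Real.exp Λ := by
  obtain ⟨A, hA, hAf⟩ := exists_smooth_primitive hf
  let i00 : JetIdx 4 := ⟨(0, 0), by decide⟩
  let i01 : JetIdx 4 := ⟨(0, 1), by decide⟩
  let i02 : JetIdx 4 := ⟨(0, 2), by decide⟩
  let i11 : JetIdx 4 := ⟨(1, 1), by decide⟩
  have hξ : ContDiff ℝ (⊤ : ℕ∞) fun P : ℝ × ℝ × (JetIdx 4 → ℝ) =>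
      (P.2.1, P.2.2 i02 - P.2.2 i01 ^ 2 / 2) := by fun_prop
  refine ⟨fun P => -A P.2.1 (P.2.2 i02 - P.2.2 i01 ^ 2 / 2),
    fun P => f P.2.1 (P.2.2 i02 - P.2.2 i01 ^ 2 / 2) * (P.2.2 i11 - Real.exp (P.2.2 i00)),
    (ContDiff.comp (g := fun p : ℝ × ℝ => A p.1 p.2) hA hξ).neg,
    (ContDiff.comp (g := fun p : ℝ × ℝ => f p.1 p.2) hf hξ).mul (by fun_prop), ?_⟩
  intro u hu t x
  have ht : HasDerivAt (fun s => pdx (pdx u) s x - pdx u s x ^ 2 / 2)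
      (pdx (pdt (pdx u)) t x - pdx u t x * pdt (pdx u) t x) t := by
    refine ((hu.pdx.pdx.hasDerivAt_pdt t x).sub
      (((hu.pdx.hasDerivAt_pdt t x).pow 2).div_const 2)).congr_deriv ?_
    rw [hu.pdx.pdt_pdx_comm]
    simp only [Nat.add_one_sub_one, pow_one, Nat.cast_ofNat]
    ring
  have hx : HasDerivAt (fun y => pdx (pdx u) t y - pdx u t y ^ 2 / 2)
      (pdx (pdx (pdx u)) t x - pdx u t x * pdx (pdx u) t x) x := by
    refine ((hu.pdx.pdx.hasDerivAt_pdx t x).sub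
      (((hu.pdx.hasDerivAt_pdx t x).pow 2).div_const 2)).congr_deriv ?_
    simp only [Nat.add_one_sub_one, pow_one, Nat.cast_ofNat]
    ring
  have hΦt := (hA.hasDerivAt_comp (hasDerivAt_const t x) ht).neg.deriv
  have hΦx := ((hf.hasDerivAt_comp (hasDerivAt_id x) hx).mul
    ((hu.pdx.pdt.hasDerivAt_pdx t x).sub (hu.hasDerivAt_pdx t x).exp)).deriv
  rw [hAf] at hΦt
  rw [h]
  refine Eq.trans ?_ (congrArg₂ (· + ·) hΦt hΦx).symm
  change (pdt (pdx u) t x - Real.exp (u t x)) *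
    (pdx f x (pdx (pdx u) t x - pdx u t x ^ 2 / 2)
        * (pdx (pdx (pdx u)) t x - pdx u t x * pdx (pdx u) t x)
      + pdt f x (pdx (pdx u) t x - pdx u t x ^ 2 / 2)
      + pdx u t x * f x (pdx (pdx u) t x - pdx u t x ^ 2 / 2)) = _
  simp only [id, Pi.sub_apply]
  ring

/-- Classification of the conservation-law multipliers `Λ(x,u,u_x,u_xx,u_xxx)`
of the Liouville equation `u_tx = eᵘ`:  they are exactly the expressions
`f_ξ(x,ξ)·(u_xxx − u_x u_xx) + f_x(x,ξ) + u_x·f(x,ξ)` with `ξ = u_xx − u_x²/2`,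
for an arbitrary smooth function `f` of two variables. -/
theorem liouville_multiplier_classification
    (Λ : ℝ → ℝ → ℝ → ℝ → ℝ → ℝ) (hΛ : Smooth5 Λ) :
    IsMultiplierKG Real.exp Λ ↔
      ∃ f : ℝ → ℝ → ℝ, ContDiff ℝ (⊤ : ℕ∞) (fun v : ℝ × ℝ => f v.1 v.2) ∧
        ∀ x u p q r : ℝ,
          Λ x u p q r
            = deriv (fun ξ => f x ξ) (q - p ^ 2 / 2) * (r - p * q)
              + deriv (fun y => f y (q - p ^ 2 / 2)) x
              + p * f x (q - p ^ 2 / 2) := by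
  refine ⟨exists_eq_of_isMultiplierKG hΛ, ?_⟩
  rintro ⟨f, hf, h⟩
  refine isMultiplierKG_of_eq (f := f) hf fun x u p q r => ?_
  exact h x u p q r
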